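/- arXiv:0801.2644 — 17 statements merged into one kernel-verified Lean document; each statement's English description precedes it below -/
import Mathlib

section
/- Let Ω and Γ be sets with |Ω| ≥ 2. If there exists a semigroup embedding from Self_{≤2}(Ω) into the dual of Self(Γ), then |Γ| ≥ 2^{|Ω|} (as cardinals). -/
/-- If `|Ω| ≥ 2` and there is a semigroup embedding of `Self_{≤2}(Ω)`
into the dual of `Self(Γ)`, then `|Γ| ≥ 2^{|Ω|}`. -/
theorem stmt_0 {Ω Γ : Type u} (hΩ : 2 ≤ Cardinal.mk Ω)
    (ε : {f : Ω → Ω // (Set.range f).encard ≤ 2} → (Γ → Γ))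
    (hinj : Function.Injective ε)
    (hanti : ∀ f g h : {f : Ω → Ω // (Set.range f).encard ≤ 2},
      h.1 = f.1 ∘ g.1 → ε h = ε g ∘ ε f) :
    2 ^ Cardinal.mk Ω ≤ Cardinal.mk Γ := by
  classical
  obtain ⟨a, b, hab⟩ := Cardinal.two_le_iff.1 hΩ
  have key : ∀ (f : Ω → Ω) (p q : Ω), (∀ x, f x = p ∨ f x = q) →
      (Set.range f).encard ≤ 2 := by
    intro f p q h
    refine le_trans (Set.encard_le_encard (t := {p, q}) ?_) ((Set.encard_insert_le _ _).trans (by rw [Set.encard_singleton]; norm_num))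
    rintro _ ⟨x, rfl⟩
    simpa using h x
  let c : Ω → {f : Ω → Ω // (Set.range f).encard ≤ 2} :=
    fun w => ⟨fun _ => w, key _ w w (fun _ => Or.inl rfl)⟩
  let F : Set Ω → {f : Ω → Ω // (Set.range f).encard ≤ 2} :=
    fun A => ⟨fun x => if x ∈ A then a else b, key _ a b (fun x => by
      by_cases h : x ∈ A <;> simp [h])⟩
  have hne : ε (c a) ≠ ε (c b) := by
    intro h
    exact hab (congrFun (congrArg Subtype.val (hinj h)) a)
  obtain ⟨x, hx⟩ := Function.ne_iff.1 hne
  have h1 : ∀ A w, w ∈ A → ε (c w) (ε (F A) x) = ε (c a) x := by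
    intro A w hw
    rw [hanti (F A) (c w) (c a) (by funext y; simp [c, F, hw])]
    rfl
  have h2 : ∀ A w, w ∉ A → ε (c w) (ε (F A) x) = ε (c b) x := by
    intro A w hw
    rw [hanti (F A) (c w) (c b) (by funext y; simp [c, F, hw])]
    rfl
  rw [← Cardinal.mk_set]
  refine Cardinal.mk_le_of_injective (f := fun A : Set Ω => ε (F A) x) ?_
  intro A B hAB
  have hAB : ε (F A) x = ε (F B) x := hAB
  ext w
  constructor
  · intro hw
    by_contra hw'
    exact hx (by rw [← h1 A w hw, ← h2 B w hw', hAB])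
  · intro hw
    by_contra hw'
    exact hx (by rw [← h1 B w hw, ← h2 A w hw', hAB])
end

section
/- Let Ω and Γ be sets with |Ω| ≥ 2. Then the following are equivalent: (i) there exists a semigroup embedding from Self_{≤2}(Ω) into the dual of Self(Γ); (ii) there exists a monoid embedding from Self(Ω) into the dual of Self(Γ) (an injective map ε sending the identity to the identity and satisfying ε(f∘g) = ε(g)∘ε(f)); (iii) |Γ| ≥ 2^{|Ω|} (as cardinals). -/
theorem aux_lower {Ω Γ : Type u} (hΩ : 2 ≤ Cardinal.mk Ω)
    (ε : {f : Ω → Ω // (Set.range f).encard ≤ 2} → (Γ → Γ))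
    (hinj : Function.Injective ε)
    (hmul : ∀ f g h : {f : Ω → Ω // (Set.range f).encard ≤ 2},
          h.1 = f.1 ∘ g.1 → ε h = ε g ∘ ε f) :
    2 ^ Cardinal.mk Ω ≤ Cardinal.mk Γ := by
  classical
  obtain ⟨a, b, hab⟩ := Cardinal.two_le_iff.1 hΩ
  have key : ∀ (x y : Ω) (f : Ω → Ω), (∀ z, f z = x ∨ f z = y) →
      (Set.range f).encard ≤ 2 := by
    intro x y f hf
    refine le_trans (Set.encard_le_encard (t := {x, y}) ?_) (le_trans (Set.encard_insert_le _ _) (by rw [Set.encard_singleton]; exact le_of_eq one_add_one_eq_two))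
    rintro _ ⟨z, rfl⟩
    simpa using hf z
  let c : Ω → {f : Ω → Ω // (Set.range f).encard ≤ 2} :=
    fun x => ⟨fun _ => x, key x x _ (fun _ => Or.inl rfl)⟩
  let F : Set Ω → {f : Ω → Ω // (Set.range f).encard ≤ 2} :=
    fun A => ⟨fun z => if z ∈ A then a else b, key a b _ (fun z => by
      by_cases h : z ∈ A <;> simp [h])⟩
  have hne : ε (c a) ≠ ε (c b) := by
    intro h
    have h1 := congrArg Subtype.val (hinj h)
    exact hab (congrFun h1 a)
  obtain ⟨γ, hγ⟩ := Function.ne_iff.1 hne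
  have hF : ∀ A x, ε (c x) (ε (F A) γ) = if x ∈ A then ε (c a) γ else ε (c b) γ := by
    intro A x
    by_cases h : x ∈ A
    · have := hmul (F A) (c x) (c a) (by funext z; simp [F, c, h])
      simp [h, this]
    · have := hmul (F A) (c x) (c b) (by funext z; simp [F, c, h])
      simp [h, this]
  rw [← Cardinal.mk_set]
  refine Cardinal.mk_le_of_injective (f := fun A => ε (F A) γ) ?_
  intro A B hAB
  ext x
  have h1 := hF A x
  have h2 := hF B x
  simp only at hAB
  rw [hAB, h2] at h1
  by_cases hA : x ∈ A <;> by_cases hB : x ∈ B <;> simp [hA, hB] at h1 ⊢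
  · exact hγ h1.symm
  · exact hγ h1

theorem aux_upper {Ω Γ : Type u} (h : 2 ^ Cardinal.mk Ω ≤ Cardinal.mk Γ) :
    ∃ ε : (Ω → Ω) → (Γ → Γ), Function.Injective ε ∧ ε id = id ∧
        ∀ f g : Ω → Ω, ε (f ∘ g) = ε g ∘ ε f := by
  classical
  rw [← Cardinal.mk_set] at h
  obtain ⟨i⟩ := h
  have hi := i.injective
  refine ⟨fun f => Function.extend i (fun A => i (f ⁻¹' A)) id, ?_, ?_, ?_⟩
  · intro f g hfg
    funext x
    have h1 := congrFun hfg (i {f x})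
    simp only [hi.extend_apply] at h1
    have h2 := hi h1
    have h3 : x ∈ g ⁻¹' {f x} := by rw [← h2]; simp
    simpa using h3.symm
  · funext y
    by_cases hy : ∃ A, i A = y
    · obtain ⟨A, rfl⟩ := hy
      simp [hi.extend_apply]
    · simp [Function.extend_apply' _ _ _ hy]
  · intro f g
    funext y
    by_cases hy : ∃ A, i A = y
    · obtain ⟨A, rfl⟩ := hy
      simp [hi.extend_apply, Set.preimage_comp]
    · simp [Function.extend_apply' _ _ _ hy]

/-- For sets `Ω`, `Γ` with `|Ω| ≥ 2`, the following are equivalent: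
(i) there is a semigroup embedding of `Self_{≤2}(Ω)` into the dual of `Self(Γ)`;
(ii) there is a monoid embedding of `Self(Ω)` into the dual of `Self(Γ)`;
(iii) `|Γ| ≥ 2^{|Ω|}`. -/
theorem stmt_1 {Ω Γ : Type u} (hΩ : 2 ≤ Cardinal.mk Ω) :
    ((∃ ε : {f : Ω → Ω // (Set.range f).encard ≤ 2} → (Γ → Γ),
        Function.Injective ε ∧
        ∀ f g h : {f : Ω → Ω // (Set.range f).encard ≤ 2},
          h.1 = f.1 ∘ g.1 → ε h = ε g ∘ ε f) ↔
      2 ^ Cardinal.mk Ω ≤ Cardinal.mk Γ) ∧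
    ((∃ ε : (Ω → Ω) → (Γ → Γ), Function.Injective ε ∧ ε id = id ∧
        ∀ f g : Ω → Ω, ε (f ∘ g) = ε g ∘ ε f) ↔
      2 ^ Cardinal.mk Ω ≤ Cardinal.mk Γ) := by
  refine ⟨⟨?_, ?_⟩, ⟨?_, aux_upper⟩⟩
  · rintro ⟨ε, h1, h2⟩
    exact aux_lower hΩ ε h1 h2
  · intro h
    obtain ⟨ε, h1, -, h2⟩ := aux_upper h
    refine ⟨fun f => ε f.1, fun f g hfg => Subtype.ext (h1 hfg), ?_⟩
    intro f g k hk
    simp only [hk, h2]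
  · rintro ⟨ε, h1, -, h2⟩
    refine aux_lower hΩ (fun f => ε f.1) (fun f g hfg => Subtype.ext (h1 hfg)) ?_
    intro f g k hk
    simp only [hk, h2]
end

section
/- Let Ω be a set with at least two elements. Then there is no semigroup embedding from Self(Ω) into the dual of PSelf(Ω); that is, there is no injective map ε from the maps Ω → Ω to the partial functions on Ω such that ε(f∘g) = ε(g)∘ε(f) for all f, g : Ω → Ω. -/
/-- If `|Ω| ≥ 2`, there is no semigroup embedding from `Self(Ω)`
into the dual of the monoid `PSelf(Ω)` of partial functions on `Ω`. -/
theorem stmt_2 {Ω : Type u} (hΩ : 2 ≤ Cardinal.mk Ω) :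
    ¬∃ ε : (Ω → Ω) → (Ω →. Ω), Function.Injective ε ∧
      ∀ f g : Ω → Ω, ε (f ∘ g) = (ε g).comp (ε f) := by
  classical
  rintro ⟨ε, hinj, hε⟩
  obtain ⟨a, b, hab⟩ := Cardinal.two_le_iff.1 hΩ
  have hne : ε (fun _ => a) ≠ ε (fun _ => b) := fun h => hab (congrFun (hinj h) a)
  obtain ⟨x, hx⟩ := Function.ne_iff.1 hne
  have key : ∀ (f : Ω → Ω) (c : Ω),
      ε (fun _ => f c) x = (ε f x).bind (ε (fun _ => c)) := by
    intro f c
    exact congrFun (hε f (fun _ => c)) x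
  have hF : Function.Injective
      (fun S : Set Ω => Part.equivOption (ε (fun c => if c ∈ S then a else b) x)) := by
    intro S T h
    have h' := Part.equivOption.injective h
    ext c
    have h1 := key (fun c => if c ∈ S then a else b) c
    have h2 := key (fun c => if c ∈ T then a else b) c
    rw [h', ← h2] at h1
    by_cases hS : c ∈ S <;> by_cases hT : c ∈ T <;> simp only [hS, hT, if_true, if_false] at h1 ⊢
    · exact absurd h1 hx
    · exact absurd h1.symm hx
  have hle := Cardinal.mk_le_of_injective hF
  rw [Cardinal.mk_set, Cardinal.mk_option] at hle
  rcases lt_or_ge (Cardinal.mk Ω) Cardinal.aleph0 with h | h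
  · obtain ⟨n, hn⟩ := Cardinal.lt_aleph0.1 h
    rw [hn] at hle hΩ
    have h2 : 2 ≤ n := by exact_mod_cast hΩ
    have h3 : 2 ^ n ≤ n + 1 := by exact_mod_cast hle
    obtain ⟨m, rfl⟩ := Nat.exists_eq_add_of_le h2
    have := Nat.lt_two_pow_self (n := m)
    rw [pow_add] at h3
    omega
  · rw [Cardinal.add_one_eq h] at hle
    exact absurd hle (not_le.2 (Cardinal.cantor _))
end

section
/- Let Ω be a set and let α and β be two distinct equivalence relations on Ω, each having exactly two equivalence classes. Then there exist idempotent maps f, g : Ω → Ω, each with range of exactly two elements, such that Ker f = α, Ker g = β, and f∘g is a constant map. -/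
lemma section_props {Ω : Type u} (r : Setoid Ω) (hr : Cardinal.mk (Quotient r) = 2)
    (s : Quotient r → Ω) (hs : ∀ q, Quotient.mk r (s q) = q) :
    (fun x => s (Quotient.mk r x)) ∘ (fun x => s (Quotient.mk r x))
        = (fun x => s (Quotient.mk r x)) ∧
      (Set.range (fun x => s (Quotient.mk r x))).encard = 2 ∧
      Setoid.ker (fun x => s (Quotient.mk r x)) = r := by
  have hinj : Function.Injective s := Function.LeftInverse.injective hs
  refine ⟨?_, ?_, ?_⟩
  · funext x
    simp [hs]
  · have h1 : Set.range (fun x => s (Quotient.mk r x)) = s '' Set.univ := by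
      ext y
      constructor
      · rintro ⟨x, rfl⟩
        exact ⟨_, trivial, rfl⟩
      · rintro ⟨q, -, rfl⟩
        exact ⟨s q, by simp [hs]⟩
    obtain ⟨x, y, hxy, h⟩ := Cardinal.mk_eq_two_iff.1 hr
    rw [h1, hinj.encard_image, ← h, Set.encard_pair hxy]
  · ext x y
    rw [Setoid.ker_def, hinj.eq_iff]
    exact Quotient.eq

/-- Given two distinct equivalence relations `α`, `β` on `Ω`, each with
exactly two classes, there are idempotent maps `f`, `g` on `Ω`, each with range of
exactly two elements, such that `Ker f = α`, `Ker g = β`, and `f ∘ g` is constant. -/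
theorem stmt_3 {Ω : Type u} (α β : Setoid Ω)
    (hα : Cardinal.mk (Quotient α) = 2) (hβ : Cardinal.mk (Quotient β) = 2)
    (hne : α ≠ β) :
    ∃ f g : Ω → Ω, f ∘ f = f ∧ g ∘ g = g ∧
      (Set.range f).encard = 2 ∧ (Set.range g).encard = 2 ∧
      Setoid.ker f = α ∧ Setoid.ker g = β ∧ ∃ c, ∀ x, f (g x) = c := by
  classical
  have key : ∃ a b, α a b ∧ ¬ β a b := by
    by_contra! hcon
    apply hne
    have : Finite (Quotient α) := by
      rw [← Cardinal.lt_aleph0_iff_finite, hα]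
      exact Cardinal.natCast_lt_aleph0 (n := 2)
    obtain ⟨e⟩ := Cardinal.eq.1 (hα.trans hβ.symm)
    let φ : Quotient α → Quotient β := Quotient.map' id hcon
    have hsurj : Function.Surjective φ := by
      intro q
      induction q using Quotient.inductionOn with
      | h x => exact ⟨Quotient.mk α x, rfl⟩
    have hinj : Function.Injective φ := by
      have h2 : Function.Injective (e.symm ∘ φ) :=
        Finite.injective_iff_surjective.2 (e.symm.surjective.comp hsurj)
      exact h2.of_comp
    ext x y
    refine ⟨hcon x y, fun h => ?_⟩
    have : φ (Quotient.mk α x) = φ (Quotient.mk α y) := Quotient.sound h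
    exact Quotient.exact (hinj this)
  obtain ⟨a, b, hab, hnab⟩ := key
  have hab' : Quotient.mk β a ≠ Quotient.mk β b := fun h => hnab (Quotient.exact h)
  have hcov : ∀ q : Quotient β, q ≠ Quotient.mk β a → q = Quotient.mk β b := by
    obtain ⟨x, y, hxy, h⟩ := Cardinal.mk_eq_two_iff.1 hβ
    have hm : ∀ q : Quotient β, q = x ∨ q = y := fun q => by
      have : q ∈ ({x, y} : Set (Quotient β)) := h ▸ Set.mem_univ q
      simpa using this
    intro q hq
    rcases hm q with h1 | h1 <;> rcases hm (Quotient.mk β a) with h2 | h2 <;>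
      rcases hm (Quotient.mk β b) with h3 | h3 <;> simp_all
  let s : Quotient β → Ω := fun q => if q = Quotient.mk β a then a else b
  have hs : ∀ q, Quotient.mk β (s q) = q := by
    intro q
    by_cases h : q = Quotient.mk β a
    · simp [s, h]
    · simp only [s, h, if_false]
      exact (hcov q h).symm
  obtain ⟨f1, f2, f3⟩ := section_props α hα Quotient.out Quotient.out_eq
  obtain ⟨g1, g2, g3⟩ := section_props β hβ s hs
  refine ⟨_, _, f1, g1, f2, g2, f3, g3, Quotient.out (Quotient.mk α a), fun x => ?_⟩
  have hm : Quotient.mk α b = Quotient.mk α a := (Quotient.sound hab).symm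
  by_cases h : Quotient.mk β x = Quotient.mk β a
  · simp only [s, h, if_true]
  · simp only [s, h, if_false, hm]
end

section
/- Let Ω and Γ be sets and let ε be a semigroup embedding from Self_{≤2}(Ω) into the dual of Self(Γ), i.e. an injective map ε from Self_{≤2}(Ω) to Self(Γ) with ε(f∘g) = ε(g)∘ε(f) for all f, g ∈ Self_{≤2}(Ω). Then: (a) for all f, g ∈ Self_{≤2}(Ω), if Ker f ⊆ Ker g then range(ε(g)) ⊆ range(ε(f)); (b) for all idempotent f, g ∈ Self_{≤2}(Ω), Ker f ⊆ Ker g if and only if range(ε(g)) ⊆ range(ε(f)). -/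
/-- For a semigroup embedding `ε` of `Self_{≤2}(Ω)` into the dual of
`Self(Γ)`: (a) `Ker f ⊆ Ker g` implies `range (ε g) ⊆ range (ε f)`; (b) for
idempotent `f`, `g`, `Ker f ⊆ Ker g` iff `range (ε g) ⊆ range (ε f)`. -/
theorem stmt_4 {Ω Γ : Type u}
    (ε : {f : Ω → Ω // (Set.range f).encard ≤ 2} → (Γ → Γ))
    (hinj : Function.Injective ε)
    (hanti : ∀ f g h : {f : Ω → Ω // (Set.range f).encard ≤ 2},
      h.1 = f.1 ∘ g.1 → ε h = ε g ∘ ε f) :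
    (∀ f g : {f : Ω → Ω // (Set.range f).encard ≤ 2},
      (∀ x y, f.1 x = f.1 y → g.1 x = g.1 y) →
        Set.range (ε g) ⊆ Set.range (ε f)) ∧
    (∀ f g : {f : Ω → Ω // (Set.range f).encard ≤ 2},
      f.1 ∘ f.1 = f.1 → g.1 ∘ g.1 = g.1 →
        ((∀ x y, f.1 x = f.1 y → g.1 x = g.1 y) ↔
          Set.range (ε g) ⊆ Set.range (ε f))) := by
  have A : ∀ f g : {f : Ω → Ω // (Set.range f).encard ≤ 2},
      (∀ x y, f.1 x = f.1 y → g.1 x = g.1 y) →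
        Set.range (ε g) ⊆ Set.range (ε f) := by
    intro f g hfg
    have key : ∃ k : Ω → Ω, g.1 = (g.1 ∘ k) ∘ f.1 := by
      rcases isEmpty_or_nonempty Ω with hΩ | hΩ
      · exact ⟨id, funext fun x => hΩ.elim x⟩
      · refine ⟨Function.invFun f.1, funext fun x => ?_⟩
        exact hfg _ _ (Function.invFun_eq (f := f.1) ⟨x, rfl⟩).symm
    obtain ⟨k, hk⟩ := key
    have e := hanti ⟨g.1 ∘ k,
      (Set.encard_le_encard (Set.range_comp_subset_range k g.1)).trans g.2⟩ f g hk
    rw [e]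
    exact Set.range_comp_subset_range _ _
  refine ⟨A, fun f g hf hg => ⟨A f g, fun hr x y hxy => ?_⟩⟩
  have ef := hanti f f f hf.symm
  have e := hanti g f ⟨g.1 ∘ f.1,
    (Set.encard_le_encard (Set.range_comp_subset_range f.1 g.1)).trans g.2⟩ rfl
  have e2 : ε f ∘ ε g = ε g := by
    funext z
    obtain ⟨w, hw⟩ := hr ⟨z, rfl⟩
    change ε f (ε g z) = ε g z
    rw [← hw]
    exact (congrFun ef w).symm
  have h := congrArg Subtype.val (hinj (e.trans e2))
  have hx : g.1 (f.1 x) = g.1 x := congrFun h x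
  have hy : g.1 (f.1 y) = g.1 y := congrFun h y
  rw [← hx, ← hy, hxy]
end

section
/- Let I be a set, K a division ring, and V a vector space over K. The following are equivalent: (i) there is a map φ from finite subsets of I to finite-dimensional subspaces of V that is injective and satisfies φ(X ∪ Y) = φ(X) + φ(Y), φ(X ∩ Y) = φ(X) ∩ φ(Y), and φ(∅) = {0}; (ii) there is an injective map φ from finite subsets of I to subspaces of V satisfying φ(X ∩ Y) = φ(X) ∩ φ(Y); (iii) |I| ≤ dim V (as cardinals). -/
/-- For a set `I`, a division ring `K`, and a `K`-vector space `V`,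
the following are equivalent: (i) `(Fin I, ∪, ∩, ∅)` embeds into the
finite-dimensional subspaces of `V` with `(+, ∩, {0})`; (ii) `(Fin I, ∩)` embeds
into `(Sub V, ∩)`; (iii) `|I| ≤ dim V`. -/
theorem stmt_5 {K V : Type u} [DivisionRing K] [AddCommGroup V] [Module K V]
    (I : Type u) [DecidableEq I] :
    ((∃ φ : Finset I → Submodule K V, Function.Injective φ ∧
        (∀ X, FiniteDimensional K (φ X)) ∧
        (∀ X Y, φ (X ∪ Y) = φ X ⊔ φ Y) ∧
        (∀ X Y, φ (X ∩ Y) = φ X ⊓ φ Y) ∧ φ ∅ = ⊥) ↔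
      Cardinal.mk I ≤ Module.rank K V) ∧
    ((∃ φ : Finset I → Submodule K V, Function.Injective φ ∧
        ∀ X Y, φ (X ∩ Y) = φ X ⊓ φ Y) ↔
      Cardinal.mk I ≤ Module.rank K V) := by
  have h32 : Cardinal.mk I ≤ Module.rank K V → ∃ φ : Finset I → Submodule K V,
      Function.Injective φ ∧ (∀ X, FiniteDimensional K (φ X)) ∧
        (∀ X Y, φ (X ∪ Y) = φ X ⊔ φ Y) ∧
        (∀ X Y, φ (X ∩ Y) = φ X ⊓ φ Y) ∧ φ ∅ = ⊥ := by
    intro h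
    let b := Module.Basis.ofVectorSpace K V
    rw [← b.mk_eq_rank''] at h
    obtain ⟨e⟩ := h
    have hv : LinearIndependent K (fun i => b (e i)) := b.linearIndependent.comp e e.injective
    generalize (fun i => b (e i)) = v at hv
    have hinj : Function.Injective (Finsupp.linearCombination K v) := hv
    refine ⟨fun X => Submodule.span K (v '' (X : Set I)), ?_, ?_, ?_, ?_, ?_⟩
    · intro X Y hXY
      have key : ∀ X Y : Finset I, Submodule.span K (v '' (X : Set I)) =
          Submodule.span K (v '' (Y : Set I)) → X ⊆ Y := by
        intro X Y h i hi
        by_contra hn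
        apply hv.notMem_span_image (s := (Y : Set I)) (x := i) (by simpa using hn)
        rw [← h]
        exact Submodule.subset_span ⟨i, by simpa using hi, rfl⟩
      exact (key X Y hXY).antisymm (key Y X hXY.symm)
    · intro X
      exact FiniteDimensional.span_of_finite K (X.finite_toSet.image v)
    · intro X Y
      simp only [Finset.coe_union, Set.image_union, Submodule.span_union]
    · intro X Y
      simp only [Finset.coe_inter, Finsupp.span_image_eq_map_linearCombination,
        Finsupp.supported_inter]
      exact Submodule.map_inf _ hinj
    · simp
  have h23 : (∃ φ : Finset I → Submodule K V, Function.Injective φ ∧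
        ∀ X Y, φ (X ∩ Y) = φ X ⊓ φ Y) → Cardinal.mk I ≤ Module.rank K V := by
    rintro ⟨φ, hi, hφ⟩
    have mono : ∀ X Y, X ⊆ Y → φ X ≤ φ Y := by
      intro X Y h
      have := hφ X Y
      rw [Finset.inter_eq_left.2 h] at this
      exact inf_eq_left.1 this.symm
    have ex : ∀ i : I, ∃ v, v ∈ φ {i} ∧ v ∉ φ ∅ := by
      intro i
      by_contra! hc
      have : φ {i} = φ ∅ := le_antisymm hc (mono _ _ (by simp))
      simpa using hi this
    choose v hv hv' using ex
    have hl : LinearIndependent K v := by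
      rw [linearIndependent_iff_notMem_span]
      intro j hj
      have : ∃ X : Finset I, j ∉ X ∧ v j ∈ φ X := by
        generalize v j = w at hj
        induction hj using Submodule.span_induction with
        | mem x hx =>
          obtain ⟨i, hi, rfl⟩ := hx
          refine ⟨{i}, ?_, hv i⟩
          simpa [eq_comm] using hi
        | zero => exact ⟨∅, by simp, zero_mem _⟩
        | add x y _ _ hx hy =>
          obtain ⟨X, h1, h2⟩ := hx
          obtain ⟨Y, h3, h4⟩ := hy
          exact ⟨X ∪ Y, by simp [h1, h3],
            add_mem (mono _ _ Finset.subset_union_left h2)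
              (mono _ _ Finset.subset_union_right h4)⟩
        | smul a x _ hx =>
          obtain ⟨X, h1, h2⟩ := hx
          exact ⟨X, h1, Submodule.smul_mem _ _ h2⟩
      obtain ⟨X, h1, h2⟩ := this
      apply hv' j
      have h3 : X ∩ {j} = ∅ := Finset.inter_singleton_of_notMem h1
      rw [← h3, hφ]
      exact ⟨h2, hv j⟩
    exact hl.cardinal_le_rank
  refine ⟨⟨?_, h32⟩, ⟨h23, ?_⟩⟩
  · rintro ⟨φ, h1, _, _, h2, _⟩
    exact h23 ⟨φ, h1, h2⟩
  · intro h
    obtain ⟨φ, h1, _, _, h2, _⟩ := h32 h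
    exact ⟨φ, h1, h2⟩
end

section
/- Let I be a set, K a division ring, and V an infinite-dimensional vector space over K. The following are equivalent: (i) there is an injective map φ from finite subsets of I to finite-codimensional subspaces of V satisfying φ(X ∪ Y) = φ(X) ∩ φ(Y), φ(X ∩ Y) = φ(X) + φ(Y), and φ(∅) = V; (ii) there is an injective map φ from finite subsets of I to subspaces of V satisfying φ(X ∩ Y) = φ(X) + φ(Y); (iii) |I| ≤ |K|^{dim V} (as cardinals). -/
theorem aux_surj {K V I : Type*} [DivisionRing K] [AddCommGroup V] [Module K V]
    (f : I → (V →ₗ[K] K)) (hf : LinearIndependent Kᵐᵒᵖ f) (X : Finset I) (c : I → K) :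
    ∃ v : V, ∀ i ∈ X, f i v = c i := by
  classical
  let L : V →ₗ[K] (X → K) := LinearMap.pi fun i => f i
  have hL : LinearMap.range L = ⊤ := by
    by_contra hne
    obtain ⟨g, hg0, hg⟩ := Submodule.exists_le_ker_of_lt_top _ (lt_top_iff_ne_top.2 hne)
    apply hg0
    have hX : LinearIndependent Kᵐᵒᵖ (fun i : X => f i) := hf.comp _ Subtype.val_injective
    have key := (Fintype.linearIndependent_iff.1 hX)
      (fun i => MulOpposite.op (g (Pi.single i 1))) (by
        ext v
        have h1 : g (L v) = 0 := hg ⟨v, rfl⟩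
        rw [LinearMap.pi_apply_eq_sum_univ g (L v)] at h1
        simp only [LinearMap.sum_apply, LinearMap.smul_apply, MulOpposite.smul_eq_mul_unop,
          MulOpposite.unop_op, LinearMap.zero_apply]
        rw [← h1]
        refine Finset.sum_congr rfl fun i _ => ?_
        rw [smul_eq_mul]
        congr 2
        ext j
        simp [Pi.single_apply, eq_comm])
    ext i
    have := key i
    simpa using this
  obtain ⟨v, hv⟩ := LinearMap.range_eq_top.1 hL (fun i => c i)
  exact ⟨v, fun i hi => congrFun hv ⟨i, hi⟩⟩

theorem aux_card {K V : Type u} [DivisionRing K] [AddCommGroup V] [Module K V]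
    (hV : Cardinal.aleph0 ≤ Module.rank K V) :
    Cardinal.mk (Submodule K V) ≤ Cardinal.mk K ^ Module.rank K V := by
  obtain ⟨⟨ι, b⟩⟩ := Module.Free.exists_basis (R := K) (M := V)
  rw [← b.mk_eq_rank''] at hV ⊢
  have : Infinite ι := Cardinal.aleph0_le_mk_iff.1 hV
  have hsurj : Function.Surjective (fun p : V →ₗ[K] V => LinearMap.range p) := by
    intro W
    obtain ⟨p, hp⟩ := LinearMap.exists_leftInverse_of_injective W.subtype (by simp)
    refine ⟨W.subtype ∘ₗ p, ?_⟩
    have hps : Function.Surjective p := fun w => ⟨w, LinearMap.congr_fun hp w⟩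
    simp [LinearMap.range_comp, LinearMap.range_eq_top.2 hps]
  have hK : (2 : Cardinal) ≤ Cardinal.mk K := Cardinal.two_le_iff.2 (exists_pair_ne K)
  calc Cardinal.mk (Submodule K V) ≤ Cardinal.mk (V →ₗ[K] V) := Cardinal.mk_le_of_surjective hsurj
    _ = Cardinal.mk (ι → V) := (b.constr ℕ (M' := V)).symm.toEquiv.cardinal_eq
    _ = Cardinal.mk V ^ Cardinal.mk ι := by simp
    _ = (max (Cardinal.mk ι) (Cardinal.mk K)) ^ Cardinal.mk ι := by
        rw [b.repr.toEquiv.cardinal_eq, Cardinal.mk_finsupp_of_infinite]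
    _ ≤ (Cardinal.mk ι * Cardinal.mk K) ^ Cardinal.mk ι := by
        apply Cardinal.power_le_power_right
        apply max_le
        · exact Cardinal.le_mul_right (by simp)
        · exact Cardinal.le_mul_left (by simp)
    _ = 2 ^ Cardinal.mk ι * Cardinal.mk K ^ Cardinal.mk ι := by
        rw [Cardinal.mul_power, Cardinal.power_self_eq hV]
    _ ≤ Cardinal.mk K ^ Cardinal.mk ι * Cardinal.mk K ^ Cardinal.mk ι :=
        mul_le_mul_left (Cardinal.power_le_power_right hK) _
    _ = Cardinal.mk K ^ Cardinal.mk ι := by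
        rw [← Cardinal.power_add, Cardinal.add_eq_self hV]

theorem aux_exists {K V : Type u} [DivisionRing K] [AddCommGroup V] [Module K V]
    (I : Type u) (hV : Cardinal.aleph0 ≤ Module.rank K V)
    (h : Cardinal.mk I ≤ Cardinal.mk K ^ Module.rank K V) :
    ∃ f : I → (V →ₗ[K] K), LinearIndependent Kᵐᵒᵖ f := by
  have h1 := rank_dual_eq_card_dual_of_aleph0_le_rank' hV
  obtain ⟨⟨κ, d⟩⟩ := Module.Free.exists_basis (R := Kᵐᵒᵖ) (M := V →ₗ[K] K)
  have h2 : Cardinal.mk I ≤ Cardinal.mk κ := by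
    rw [d.mk_eq_rank'', h1]
    obtain ⟨⟨ι, b⟩⟩ := Module.Free.exists_basis (R := K) (M := V)
    rw [← b.mk_eq_rank''] at h
    rw [← (b.constr ℕ (M' := K)).toEquiv.cardinal_eq]
    simpa using h
  obtain ⟨e⟩ := h2
  exact ⟨d ∘ e, d.linearIndependent.comp _ e.injective⟩

theorem aux_main {K V : Type u} [DivisionRing K] [AddCommGroup V] [Module K V]
    (I : Type u) [DecidableEq I] (hV : Cardinal.aleph0 ≤ Module.rank K V)
    (h : Cardinal.mk I ≤ Cardinal.mk K ^ Module.rank K V) :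
    ∃ φ : Finset I → Submodule K V, Function.Injective φ ∧
        (∀ X, FiniteDimensional K (V ⧸ φ X)) ∧
        (∀ X Y, φ (X ∪ Y) = φ X ⊓ φ Y) ∧
        (∀ X Y, φ (X ∩ Y) = φ X ⊔ φ Y) ∧ φ ∅ = ⊤ := by
  obtain ⟨f, hf⟩ := aux_exists I hV h
  let φ : Finset I → Submodule K V := fun X =>
    LinearMap.ker (LinearMap.pi (fun i : X => f i) : V →ₗ[K] (X → K))
  have mem : ∀ X v, v ∈ φ X ↔ ∀ i ∈ X, f i v = 0 := by
    intro X v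
    simp [φ, funext_iff]
  have le : ∀ X Y, φ X ≤ φ Y → Y ⊆ X := by
    intro X Y hXY i hi
    by_contra hiX
    obtain ⟨v, hv⟩ := aux_surj f hf (insert i X) (fun j => if j = i then 1 else 0)
    have h1 : v ∈ φ X := (mem _ _).2 fun j hj => by
      rw [hv j (by simp [hj]), if_neg (by rintro rfl; exact hiX hj)]
    have h2 := (mem _ _).1 (hXY h1) i hi
    rw [hv i (by simp)] at h2
    simp at h2
  refine ⟨φ, ?_, ?_, ?_, ?_, ?_⟩
  · intro X Y hXY
    exact (le Y X hXY.ge).antisymm (le X Y hXY.le)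
  · intro X
    exact Module.Finite.equiv
      (LinearMap.quotKerEquivRange (LinearMap.pi (fun i : X => f i) : V →ₗ[K] (X → K))).symm
  · intro X Y
    ext v
    simp only [Submodule.mem_inf, mem, Finset.mem_union]
    grind
  · intro X Y
    apply _root_.le_antisymm
    · intro v hv
      rw [mem] at hv
      obtain ⟨w, hw⟩ := aux_surj f hf (X ∪ Y) (fun j => if j ∈ X then 0 else f j v)
      rw [Submodule.mem_sup]
      refine ⟨w, (mem _ _).2 ?_, v - w, (mem _ _).2 ?_, by abel⟩
      · intro i hi
        rw [hw i (by simp [hi]), if_pos hi]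
      · intro i hi
        rw [map_sub, hw i (by simp [hi])]
        split_ifs with hX
        · rw [hv i (by simp [hi, hX]), sub_zero]
        · exact sub_self _
    · apply sup_le
      · intro v hv
        exact (mem _ _).2 fun i hi => (mem _ _).1 hv i (Finset.mem_inter.1 hi).1
      · intro v hv
        exact (mem _ _).2 fun i hi => (mem _ _).1 hv i (Finset.mem_inter.1 hi).2
  · ext v
    simp [mem]


/-- For a set `I`, a division ring `K`, and an infinite-dimensional
`K`-vector space `V`, the following are equivalent: (i) `(Fin I, ∪, ∩, ∅)` embeds
into the finite-codimensional subspaces of `V` with `(∩, +, V)`; (ii) `(Fin I, ∩)`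
embeds into `(Sub V, +)`; (iii) `|I| ≤ |K|^{dim V}`. -/
theorem stmt_6 {K V : Type u} [DivisionRing K] [AddCommGroup V] [Module K V]
    (I : Type u) [DecidableEq I] (hV : Cardinal.aleph0 ≤ Module.rank K V) :
    ((∃ φ : Finset I → Submodule K V, Function.Injective φ ∧
        (∀ X, FiniteDimensional K (V ⧸ φ X)) ∧
        (∀ X Y, φ (X ∪ Y) = φ X ⊓ φ Y) ∧
        (∀ X Y, φ (X ∩ Y) = φ X ⊔ φ Y) ∧ φ ∅ = ⊤) ↔
      Cardinal.mk I ≤ Cardinal.mk K ^ Module.rank K V) ∧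
    ((∃ φ : Finset I → Submodule K V, Function.Injective φ ∧
        ∀ X Y, φ (X ∩ Y) = φ X ⊔ φ Y) ↔
      Cardinal.mk I ≤ Cardinal.mk K ^ Module.rank K V) := by
  have key : ∀ φ : Finset I → Submodule K V, Function.Injective φ →
      Cardinal.mk I ≤ Cardinal.mk K ^ Module.rank K V := fun φ hφ =>
    (Cardinal.mk_le_of_injective (hφ.comp Finset.singleton_injective)).trans (aux_card hV)
  refine ⟨⟨fun ⟨φ, hφ, _⟩ => key φ hφ, aux_main I hV⟩, ⟨fun ⟨φ, hφ, _⟩ => key φ hφ, fun h => ?_⟩⟩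
  obtain ⟨φ, h1, _, _, h4, _⟩ := aux_main (K := K) (V := V) I hV h
  exact ⟨φ, h1, h4⟩
end

section
/- Let V and W be vector spaces over division rings K and F respectively, with V infinite-dimensional. If there exists an injective map φ from the finite-codimensional subspaces of V to the subspaces of W satisfying φ(X + Y) = φ(X) ∩ φ(Y) for all finite-codimensional subspaces X, Y of V, then dim W ≥ |K|^{dim V} (as cardinals). -/
theorem stmt7_aux {K V : Type*} [DivisionRing K] [AddCommGroup V] [Module K V]
    {ι : Type*} (f : ι → V →ₗ[K] K) (S : Finset ι) : ∀ g : V →ₗ[K] K,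
    (∀ x, (∀ i ∈ S, f i x = 0) → g x = 0) → g ∈ Submodule.span Kᵐᵒᵖ (f '' (S : Set ι)) := by
  classical
  induction S using Finset.induction_on with
  | empty =>
    intro g hg
    have : g = 0 := LinearMap.ext fun x => hg x (by simp)
    rw [this]; exact Submodule.zero_mem _
  | insert a S ha ih =>
    intro g hg
    have hmono : Submodule.span Kᵐᵒᵖ (f '' (S : Set ι)) ≤
        Submodule.span Kᵐᵒᵖ (f '' ((insert a S : Finset ι) : Set ι)) :=
      Submodule.span_mono (Set.image_mono (by simp))
    by_cases h : ∀ x, (∀ i ∈ S, f i x = 0) → f a x = 0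
    · refine hmono (ih g fun x hx => hg x fun i hi => ?_)
      rcases Finset.mem_insert.1 hi with rfl | hi
      · exact h x hx
      · exact hx i hi
    · push Not at h
      obtain ⟨x, hx, hax⟩ := h
      have h1 := ih (g - MulOpposite.op ((f a x)⁻¹ * g x) • f a) (by
        intro y hy
        have := hg (y - (f a y * (f a x)⁻¹) • x) (by
          intro i hi
          rcases Finset.mem_insert.1 hi with rfl | hi
          · simp [mul_assoc, hax]
          · simp [hx i hi, hy i hi])
        simpa [mul_assoc] using this)
      have h2 : f a ∈ Submodule.span Kᵐᵒᵖ (f '' ((insert a S : Finset ι) : Set ι)) :=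
        Submodule.subset_span ⟨a, by simp, rfl⟩
      have h3 := Submodule.add_mem _ (hmono h1)
        (Submodule.smul_mem _ (MulOpposite.op ((f a x)⁻¹ * g x)) h2)
      simpa using h3

theorem stmt7_fin {K V : Type*} [DivisionRing K] [AddCommGroup V] [Module K V]
    {ι : Type*} (f : ι → V →ₗ[K] K) (S : Finset ι) :
    FiniteDimensional K (V ⧸ LinearMap.ker (LinearMap.pi (fun i : S => f i))) :=
  Module.Finite.equiv (LinearMap.quotKerEquivRange (LinearMap.pi (fun i : S => f i))).symm

/-- If `V` is an infinite-dimensional vector space over a division ring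
`K`, `W` a vector space over a division ring `F`, and there is an embedding of the
finite-codimensional subspaces of `V` with `+` into the subspaces of `W` with `∩`,
then `dim W ≥ |K|^{dim V}`. -/
theorem stmt_7 {K V : Type u} [DivisionRing K] [AddCommGroup V] [Module K V]
    {F W : Type u} [DivisionRing F] [AddCommGroup W] [Module F W]
    (hV : Cardinal.aleph0 ≤ Module.rank K V)
    (φ : {X : Submodule K V // FiniteDimensional K (V ⧸ X)} → Submodule F W)
    (hinj : Function.Injective φ)
    (hφ : ∀ X Y Z : {X : Submodule K V // FiniteDimensional K (V ⧸ X)},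
      Z.1 = X.1 ⊔ Y.1 → φ Z = φ X ⊓ φ Y) :
    Cardinal.mk K ^ Module.rank K V ≤ Module.rank F W := by
  classical
  obtain ⟨⟨ι, b⟩⟩ := Module.Free.exists_basis (R := Kᵐᵒᵖ) (M := V →ₗ[K] K)
  have hι : Cardinal.mk K ^ Module.rank K V = Cardinal.mk ι := by
    rw [b.mk_eq_rank'', rank_dual_eq_card_dual_of_aleph0_le_rank' hV]
    obtain ⟨⟨κ, c⟩⟩ := Module.Free.exists_basis (R := K) (M := V)
    rw [← c.mk_eq_rank'', ← (c.constr ℕ (M' := K)).toEquiv.cardinal_eq]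
    simp
  rw [hι]
  let X : Finset ι → {X : Submodule K V // FiniteDimensional K (V ⧸ X)} :=
    fun S => ⟨LinearMap.ker (LinearMap.pi (fun i : S => b i)), stmt7_fin b S⟩
  have hX : ∀ S x, x ∈ (X S).1 ↔ ∀ i ∈ S, b i x = 0 := by
    intro S x
    simp [X, funext_iff]
  let T : {X : Submodule K V // FiniteDimensional K (V ⧸ X)} := ⟨⊤, inferInstance⟩
  have hanti : ∀ P Q, P.1 ≤ Q.1 → φ Q ≤ φ P := by
    intro P Q h
    rw [hφ P Q Q (sup_eq_right.2 h).symm]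
    exact inf_le_left
  have hsep : ∀ i S, i ∉ S → ∃ x, x ∈ (X S).1 ∧ b i x ≠ 0 := by
    intro i S hi
    by_contra hcon
    push Not at hcon
    have := stmt7_aux b S (b i) fun x hx => hcon x ((hX S x).2 hx)
    exact b.linearIndependent.notMem_span_image (s := (S : Set ι)) (by simpa using hi) this
  have hv : ∀ i, ∃ v, v ∈ φ (X {i}) ∧ v ∉ φ T := by
    intro i
    by_contra hcon
    push Not at hcon
    have h1 : φ (X {i}) = φ T := le_antisymm hcon (hanti _ _ le_top)
    have h2 := hinj h1
    obtain ⟨x, -, hx⟩ := hsep i ∅ (by simp)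
    apply hx
    have : x ∈ (X {i}).1 := by rw [h2]; trivial
    exact (hX _ _).1 this i (by simp)
  choose v hv hvT using hv
  have hli : LinearIndependent F v := by
    rw [linearIndependent_iff_notMem_span]
    intro i hi
    rw [Submodule.mem_span_image_iff_exists_fun] at hi
    obtain ⟨S, hS, c, hc⟩ := hi
    have hiS : i ∉ S := fun h => (hS h).2 rfl
    have hmem : v i ∈ φ (X S) := by
      rw [← hc]
      refine Submodule.sum_mem _ fun j _ => Submodule.smul_mem _ _ ?_
      refine hanti (X S) (X {j.1}) (fun x hx => ?_) (hv j.1)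
      rw [hX] at hx ⊢
      intro k hk
      rw [Finset.mem_singleton.1 hk]
      exact hx _ j.2
    apply hvT i
    rw [hφ (X {i}) (X S) T]
    · exact ⟨hv i, hmem⟩
    · symm
      change _ = (⊤ : Submodule K V)
      rw [eq_top_iff]
      intro y _
      obtain ⟨x, hx, hx0⟩ := hsep i S hiS
      refine Submodule.mem_sup.2 ⟨y - (b i y * (b i x)⁻¹) • x, ?_,
        (b i y * (b i x)⁻¹) • x, Submodule.smul_mem _ _ hx, by simp⟩
      rw [hX]
      intro k hk
      rw [Finset.mem_singleton.1 hk]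
      simp [mul_assoc, hx0]
  exact hli.cardinal_le_rank
end

section
/- Let V be an infinite-dimensional vector space over a division ring K. Then there is no injective map φ from the finite-codimensional subspaces of V to the subspaces of V satisfying φ(X + Y) = φ(X) ∩ φ(Y) for all finite-codimensional subspaces X, Y of V. -/
theorem helper_span {K V ι : Type*} [DivisionRing K] [AddCommGroup V] [Module K V]
    (f : ι → V →ₗ[K] K) (hf : LinearIndependent Kᵐᵒᵖ f) (F : Finset ι) (j : ι) (hj : j ∉ F) :
    ¬ (LinearMap.ker (LinearMap.pi fun i : F => f i) ≤ LinearMap.ker (f j)) := by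
  classical
  intro h
  set T : V →ₗ[K] (F → K) := LinearMap.pi fun i : F => f i with hT
  obtain ⟨g, hg⟩ := LinearMap.exists_extend
    (((LinearMap.ker T).liftQ (f j) h).comp T.quotKerEquivRange.symm.toLinearMap)
  have key : ∀ v, f j v = g (T v) := by
    intro v
    have := LinearMap.congr_fun hg (T.quotKerEquivRange (Submodule.Quotient.mk v))
    simp only [LinearMap.comp_apply, LinearEquiv.coe_coe, LinearEquiv.symm_apply_apply] at this
    exact this.symm
  have hsum : f j = ∑ i : F, MulOpposite.op (g (Pi.single i 1)) • f i := by
    ext v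
    rw [key, LinearMap.sum_apply]
    conv_lhs => rw [← Finset.univ_sum_single (T v)]
    rw [map_sum]
    refine Finset.sum_congr rfl fun i _ => ?_
    have : (Pi.single i (T v i) : F → K) = (T v i) • Pi.single i 1 := by
      rw [← Pi.single_smul]; simp
    rw [this, map_smul]
    simp [hT]
  have hn := linearIndependent_iff_notMem_span.1 hf j
  apply hn
  rw [hsum]
  refine Submodule.sum_mem _ fun i _ => Submodule.smul_mem _ _ (Submodule.subset_span ?_)
  refine ⟨i, ⟨trivial, ?_⟩, rfl⟩
  rintro h
  exact hj (h ▸ i.2)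

/-- For an infinite-dimensional vector space `V` over a division ring
`K`, there is no embedding of the finite-codimensional subspaces of `V` with `+`
into the subspaces of `V` with `∩`. -/
theorem stmt_8 {K V : Type u} [DivisionRing K] [AddCommGroup V] [Module K V]
    (hV : Cardinal.aleph0 ≤ Module.rank K V) :
    ¬∃ φ : {X : Submodule K V // FiniteDimensional K (V ⧸ X)} → Submodule K V,
      Function.Injective φ ∧
      ∀ X Y Z : {X : Submodule K V // FiniteDimensional K (V ⧸ X)},
        Z.1 = X.1 ⊔ Y.1 → φ Z = φ X ⊓ φ Y := by
  classical
  rintro ⟨φ, hinj, hφ⟩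
  have hlt : Module.rank K V < Module.rank Kᵐᵒᵖ (V →ₗ[K] K) := by
    exact rank_lt_rank_dual' hV
  let b := Module.Free.chooseBasis Kᵐᵒᵖ (V →ₗ[K] K)
  have hb : LinearIndependent Kᵐᵒᵖ b := b.linearIndependent
  have hfin : ∀ F : Finset (Module.Free.ChooseBasisIndex Kᵐᵒᵖ (V →ₗ[K] K)),
      FiniteDimensional K (V ⧸ LinearMap.ker (LinearMap.pi fun i : F => b i)) := fun F =>
    Module.Finite.equiv (LinearMap.pi fun i : F => b i).quotKerEquivRange.symm
  have hfin1 : ∀ i, FiniteDimensional K (V ⧸ LinearMap.ker (b i)) := fun i =>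
    Module.Finite.equiv (b i).quotKerEquivRange.symm
  have hfinT : FiniteDimensional K (V ⧸ (⊤ : Submodule K V)) := inferInstance
  have h1 : ∀ i, ∃ v ∈ φ ⟨_, hfin1 i⟩, v ∉ φ ⟨⊤, hfinT⟩ := by
    intro i
    by_contra! hc
    have e := hφ ⟨_, hfin1 i⟩ ⟨⊤, hfinT⟩ ⟨⊤, hfinT⟩ (by simp)
    have e2 : φ ⟨_, hfin1 i⟩ = φ ⟨⊤, hfinT⟩ := by
      rw [e]; exact (inf_eq_left.2 hc).symm
    have e3 := congrArg Subtype.val (hinj e2)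
    exact hb.ne_zero i (LinearMap.ker_eq_top.1 e3)
  choose v hv hv' using h1
  have hnot : ¬ LinearIndependent K (fun i => (φ ⟨⊤, hfinT⟩).mkQ (v i)) := by
    intro hli
    have c1 := hli.cardinal_le_rank
    have c2 := rank_quotient_le (φ ⟨⊤, hfinT⟩)
    have c3 := b.mk_eq_rank''
    rw [c3] at c1
    exact absurd hlt (not_lt.2 (c1.trans c2))
  rw [not_linearIndependent_iff] at hnot
  obtain ⟨s, g, hs, j, hjs, hgj⟩ := hnot
  have hmem : ∑ i ∈ s, g i • v i ∈ φ ⟨⊤, hfinT⟩ := by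
    rw [← Submodule.ker_mkQ (φ ⟨⊤, hfinT⟩), LinearMap.mem_ker, map_sum]
    simpa using hs
  have hle : ∀ i ∈ s.erase j, φ ⟨_, hfin1 i⟩ ≤ φ ⟨_, hfin (s.erase j)⟩ := by
    intro i hi
    have := hφ ⟨_, hfin (s.erase j)⟩ ⟨_, hfin1 i⟩ ⟨_, hfin1 i⟩ (by
      refine (sup_eq_right.2 ?_).symm
      intro x hx
      exact congrFun (LinearMap.mem_ker.1 hx) ⟨i, hi⟩)
    rw [this]; exact inf_le_left
  have htop := hφ ⟨_, hfin (s.erase j)⟩ ⟨_, hfin1 j⟩ ⟨⊤, hfinT⟩ (by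
    have hn := helper_span b hb (s.erase j) j (by simp)
    obtain ⟨x, hx, hxj⟩ := SetLike.not_le_iff_exists.1 hn
    have hxj' : b j x ≠ 0 := hxj
    refine (eq_top_iff.2 fun y _ => ?_).symm
    have : y = (b j y * (b j x)⁻¹) • x + (y - (b j y * (b j x)⁻¹) • x) := by abel
    rw [this]
    refine Submodule.add_mem_sup (Submodule.smul_mem _ _ hx) ?_
    simp [LinearMap.mem_ker, hxj'])
  apply hv' j
  rw [htop]
  refine ⟨?_, hv j⟩
  rw [← Finset.add_sum_erase _ _ hjs] at hmem
  have hm2 : g j • v j + ∑ i ∈ s.erase j, g i • v i ∈ φ ⟨_, hfin (s.erase j)⟩ := by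
    rw [htop] at hmem; exact hmem.1
  have hm3 : ∑ i ∈ s.erase j, g i • v i ∈ φ ⟨_, hfin (s.erase j)⟩ :=
    Submodule.sum_mem _ fun i hi => Submodule.smul_mem _ _ (hle i hi (hv i))
  exact (Submodule.smul_mem_iff _ hgj).1 ((Submodule.add_mem_iff_left _ hm3).1 hm2)
end

section
/- Let V be an infinite-dimensional vector space over a division ring F such that |F| ≤ dim V (as cardinals). Then there exists an injective map φ from the subspaces of V to the subspaces of V satisfying φ(X ∩ Y) = φ(X) + φ(Y) for all subspaces X, Y of V; that is, (Sub V, ∩) embeds into (Sub V, +). -/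
/-- If `V` is an infinite-dimensional vector space over a division ring
`F` with `|F| ≤ dim V`, then `(Sub V, ∩)` embeds into `(Sub V, +)`. -/
theorem stmt_9 {F V : Type u} [DivisionRing F] [AddCommGroup V] [Module F V]
    (hV : Cardinal.aleph0 ≤ Module.rank F V)
    (hF : Cardinal.mk F ≤ Module.rank F V) :
    ∃ φ : Submodule F V → Submodule F V, Function.Injective φ ∧
      ∀ X Y : Submodule F V, φ (X ⊓ Y) = φ X ⊔ φ Y := by
  let b := Module.Basis.ofVectorSpace F V
  have hb := b.mk_eq_rank''
  rw [← hb] at hV hF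
  have : Infinite (Module.Basis.ofVectorSpaceIndex F V) := Cardinal.infinite_iff.2 hV
  have hc : Cardinal.mk (Module.Basis.ofVectorSpaceIndex F V) = Cardinal.mk V := by
    rw [Cardinal.mk_congr b.repr.toEquiv, Cardinal.mk_finsupp_of_infinite]
    exact (max_eq_left hF).symm
  obtain ⟨e⟩ := Cardinal.eq.1 hc
  have key : ∀ X : Submodule F V, ∀ i,
      b i ∈ Submodule.span F (b '' {i | e i ∉ X}) ↔ e i ∉ X := by
    intro X i
    exact b.self_mem_span_image
  refine ⟨fun X => Submodule.span F (b '' {i | e i ∉ X}), ?_, ?_⟩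
  · intro X Y h
    ext v
    have h1 := key X (e.symm v)
    have h2 := key Y (e.symm v)
    dsimp only at h
    rw [h, h2] at h1
    simpa using (not_iff_not.1 h1).symm
  · intro X Y
    rw [← Submodule.span_union, ← Set.image_union]
    have hs : {i | e i ∉ X ⊓ Y} = {i | e i ∉ X} ∪ {i | e i ∉ Y} := by
      ext i
      simp only [Submodule.mem_inf, Set.mem_ofPred_eq, Set.mem_union]
      tauto
    beta_reduce
    rw [hs]
end

section
/- Let V and W be infinite-dimensional vector spaces over division rings K and F respectively. If there exists a semigroup embedding from End_fin(V) into the dual of End(W), i.e. an injective map ε from the finite-rank linear endomorphisms of V to the linear endomorphisms of W satisfying ε(f∘g) = ε(g)∘ε(f) for all finite-rank f, g, then dim W ≥ |K|^{dim V} (as cardinals). -/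
/-- Finitely many right-linearly independent functionals can be given prescribed values. -/
theorem aux_exists_dual_vec {K V ι : Type*} [DivisionRing K] [AddCommGroup V] [Module K V]
    [DecidableEq ι] (b : ι → (V →ₗ[K] K)) (hb : LinearIndependent Kᵐᵒᵖ b) (s : Finset ι) (i : ι) :
    ∃ w : V, ∀ j ∈ s, b j w = if j = i then 1 else 0 := by
  let T : V →ₗ[K] (s → K) := LinearMap.pi fun j => b j
  have hT : LinearMap.range T = ⊤ := by
    by_contra hne
    obtain ⟨f, hf0, hf⟩ := Submodule.exists_le_ker_of_lt_top _ (lt_top_iff_ne_top.2 hne)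
    apply hf0
    have hs : LinearIndependent Kᵐᵒᵖ (fun j : s => b j) := hb.comp _ Subtype.val_injective
    rw [Fintype.linearIndependent_iff] at hs
    have hz := hs (fun j => MulOpposite.op (f (Pi.single j 1))) (by
      ext v
      have h1 : f (T v) = 0 := hf ⟨v, rfl⟩
      rw [LinearMap.pi_apply_eq_sum_univ f (T v)] at h1
      have h2 : ∀ j : s, (fun k : s => if j = k then (1 : K) else 0) = Pi.single j 1 := by
        intro j
        ext k
        simp [Pi.single_apply, eq_comm]
      simp only [h2] at h1
      simpa [LinearMap.sum_apply, T] using h1)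
    refine LinearMap.pi_ext' fun j => LinearMap.ext_ring ?_
    simpa using hz j
  obtain ⟨w, hw⟩ := LinearMap.range_eq_top.1 hT (fun j => if (j : ι) = i then 1 else 0)
  exact ⟨w, fun j hj => congrFun hw ⟨j, hj⟩⟩

/-- If `V`, `W` are infinite-dimensional vector spaces over division
rings `K`, `F` and there is a semigroup embedding from `End_fin(V)` into the dual of
`End(W)`, then `dim W ≥ |K|^{dim V}`. -/
theorem stmt_10 {K V : Type u} [DivisionRing K] [AddCommGroup V] [Module K V]
    {F W : Type u} [DivisionRing F] [AddCommGroup W] [Module F W]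
    (hV : Cardinal.aleph0 ≤ Module.rank K V)
    (hW : Cardinal.aleph0 ≤ Module.rank F W)
    (ε : {f : V →ₗ[K] V // FiniteDimensional K (LinearMap.range f)} → (W →ₗ[F] W))
    (hinj : Function.Injective ε)
    (hanti : ∀ f g h : {f : V →ₗ[K] V // FiniteDimensional K (LinearMap.range f)},
      h.1 = f.1 ∘ₗ g.1 → ε h = ε g ∘ₗ ε f) :
    Cardinal.mk K ^ Module.rank K V ≤ Module.rank F W := by
  classical
  have hfd : ∀ (φ : V →ₗ[K] K) (v : V),
      FiniteDimensional K (LinearMap.range (φ.smulRight v)) := by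
    intro φ v
    refine Submodule.finiteDimensional_of_le (S₂ := Submodule.span K {v}) ?_
    rintro _ ⟨x, rfl⟩
    exact Submodule.smul_mem _ _ (Submodule.mem_span_singleton_self v)
  let t : V → (V →ₗ[K] K) → {f : V →ₗ[K] V // FiniteDimensional K (LinearMap.range f)} :=
    fun v φ => ⟨φ.smulRight v, hfd φ v⟩
  let z := t 0 0
  have hz0 : z.1 = 0 := by ext; simp [z, t]
  -- the normalized map, sending zero to zero
  let δ : {f : V →ₗ[K] V // FiniteDimensional K (LinearMap.range f)} → (W →ₗ[F] W) :=
    fun f => ε f - ε z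
  have hδ0 : δ z = 0 := sub_self _
  have hδ : ∀ f g h : {f : V →ₗ[K] V // FiniteDimensional K (LinearMap.range f)},
      h.1 = f.1 ∘ₗ g.1 → δ h = δ g ∘ₗ δ f := by
    intro f g h hh
    have h1 := hanti f g h hh
    have h2 := hanti z g z (by simp [hz0])
    have h3 := hanti f z z (by simp [hz0])
    have h4 := hanti z z z (by simp [hz0])
    simp only [δ, LinearMap.sub_comp, LinearMap.comp_sub, ← h1, ← h2, ← h3, ← h4]
    abel
  obtain ⟨v0, hv0⟩ : ∃ v : V, v ≠ 0 := by
    have : Nontrivial V := by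
      refine (rank_pos_iff_nontrivial (R := K)).1 (lt_of_lt_of_le Cardinal.aleph0_pos hV)
    exact exists_ne 0
  obtain ⟨φ0, hφ0⟩ : ∃ φ : V →ₗ[K] K, φ v0 = 1 := by
    obtain ⟨φ, -, h⟩ := LinearMap.exists_extend_of_notMem (p := (⊥ : Submodule K V))
      (0 : (⊥ : Submodule K V) →ₗ[K] K) (v := v0) (by simpa using hv0) 1
    exact ⟨φ, h⟩
  have hne : δ (t v0 φ0) ≠ 0 := by
    intro h
    have h1 := congrArg Subtype.val (hinj (sub_eq_zero.1 h))
    rw [hz0] at h1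
    have h2 := LinearMap.congr_fun h1 v0
    simp [t, hφ0, hv0] at h2
  obtain ⟨x, hx⟩ : ∃ x, δ (t v0 φ0) x ≠ 0 := by
    by_contra! h
    exact hne (LinearMap.ext h)
  have hmul : ∀ (φ : V →ₗ[K] K) (w : V), δ (t w φ0) ∘ₗ δ (t v0 φ) = δ (t (φ w • v0) φ0) := by
    intro φ w
    refine (hδ _ _ _ ?_).symm
    ext y
    simp [t, mul_smul]
  set u := δ (t v0 φ0) x with hu
  have huu : δ (t v0 φ0) u = u := by
    have := LinearMap.congr_fun (hmul φ0 v0) x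
    simpa [hφ0] using this
  have ht0 : t 0 φ0 = z := Subtype.ext (by ext; simp [t, z])
  obtain ⟨⟨ι, b⟩⟩ := Module.Free.exists_basis (R := Kᵐᵒᵖ) (M := V →ₗ[K] K)
  have hli : LinearIndependent F (fun i : ι => δ (t v0 (b i)) u) := by
    rw [linearIndependent_iff']
    intro s g hg i hi
    obtain ⟨w, hw⟩ := aux_exists_dual_vec b b.linearIndependent s i
    have h1 := congrArg (δ (t w φ0)) hg
    rw [map_sum, map_zero, Finset.sum_eq_single_of_mem i hi] at h1
    · have h2 := LinearMap.congr_fun (hmul (b i) w) u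
      rw [LinearMap.comp_apply, hw i hi, if_pos rfl, one_smul, huu] at h2
      rw [map_smul, h2] at h1
      exact (smul_eq_zero.1 h1).resolve_right hx
    · intro j hj hji
      have h2 := LinearMap.congr_fun (hmul (b j) w) u
      rw [LinearMap.comp_apply, hw j hj, if_neg hji, zero_smul, ht0, hδ0] at h2
      rw [map_smul, h2]
      simp
  have hcard := hli.cardinal_le_rank
  rw [b.mk_eq_rank'', rank_dual_eq_card_dual_of_aleph0_le_rank' hV] at hcard
  obtain ⟨⟨κ, c⟩⟩ := Module.Free.exists_basis (R := K) (M := V)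
  rw [← (c.constr ℕ (M' := K)).toEquiv.cardinal_eq] at hcard
  rw [← c.mk_eq_rank'']
  simpa using hcard
end

section
/- Let Ω be an infinite set and let V be a vector space over a division ring. If there exists a semigroup embedding from Self_fin(Ω) into the dual of End(V), i.e. an injective map ε from the finite-range maps Ω → Ω to the linear endomorphisms of V satisfying ε(f∘g) = ε(g)∘ε(f), then dim V ≥ 2^{|Ω|} (as cardinals). -/
theorem stmt_12 {Ω : Type u} [Infinite Ω]
    {K V : Type u} [DivisionRing K] [AddCommGroup V] [Module K V]
    (ε : {f : Ω → Ω // (Set.range f).Finite} → (V →ₗ[K] V))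
    (hinj : Function.Injective ε)
    (hanti : ∀ f g h : {f : Ω → Ω // (Set.range f).Finite},
      h.1 = f.1 ∘ g.1 → ε h = ε g ∘ₗ ε f) :
    2 ^ Cardinal.mk Ω ≤ Module.rank K V := by
  classical
  let c : Ω → {f : Ω → Ω // (Set.range f).Finite} := fun a =>
    ⟨fun _ => a, (Set.finite_singleton a).subset (by rintro _ ⟨_, rfl⟩; rfl)⟩
  obtain ⟨a, b, hab⟩ := exists_pair_ne Ω
  have hc : c a ≠ c b := fun h => hab (congrFun (congrArg Subtype.val h) a)
  have hE : ε (c a) ≠ ε (c b) := fun h => hc (hinj h)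
  obtain ⟨v, hv⟩ : ∃ v, ε (c a) v ≠ ε (c b) v := by
    by_contra! h
    exact hE (LinearMap.ext h)
  have hcomp : ∀ x f, ∀ u, ε (c x) (ε f u) = ε (c (f.1 x)) u := by
    intro x f u
    rw [hanti f (c x) (c (f.1 x)) rfl]; rfl
  have hcard : Cardinal.mk Ω = Cardinal.mk (Finset Ω × Finset Ω) := by
    simp
  obtain ⟨e⟩ := Cardinal.eq.1 hcard
  let S : Set Ω → Set Ω := fun A => {x | ∀ y ∈ (e x).1, (y ∈ A ↔ y ∈ (e x).2)}
  let f : Set Ω → {f : Ω → Ω // (Set.range f).Finite} := fun A =>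
    ⟨fun x => if x ∈ S A then b else a, (Set.toFinite {a, b}).subset (by
      rintro _ ⟨x, rfl⟩
      by_cases h : x ∈ S A <;> simp [h])⟩
  let w : Set Ω → V := fun A => ε (f A) v - ε (c a) v
  have hw : ∀ A x, ε (c x) (w A) = if x ∈ S A then ε (c b) v - ε (c a) v else 0 := by
    intro A x
    simp only [w, map_sub, hcomp]
    by_cases h : x ∈ S A <;> simp [f, c, h]
  have hli : LinearIndependent K w := by
    rw [linearIndependent_iff']
    intro s g hs A hA
    have hsep : ∀ B : Set Ω, ∃ x, B ≠ A → ¬ (x ∈ B ↔ x ∈ A) := by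
      intro B
      by_contra! h
      exact (h a).1 (Set.ext fun x => (h x).2)
    choose p hp using hsep
    let F := s.image p
    let x := e.symm (F, F.filter (· ∈ A))
    have hx : ∀ B ∈ s, (x ∈ S B ↔ B = A) := by
      intro B hB
      constructor
      · intro h
        by_contra hne
        have hF : p B ∈ F := Finset.mem_image_of_mem p hB
        have := h (p B) (by simpa [x] using hF)
        exact hp B hne (by simpa [x, hF] using this)
      · rintro rfl y hy
        simp only [x, Equiv.apply_symm_apply] at hy ⊢
        simp [hy]
    have h0 := congrArg (ε (c x)) hs
    rw [map_sum, map_zero] at h0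
    rw [Finset.sum_eq_single_of_mem A hA] at h0
    · rw [map_smul, hw, if_pos ((hx A hA).2 rfl)] at h0
      exact (smul_eq_zero.1 h0).resolve_right (sub_ne_zero.2 hv.symm)
    · intro B hB hne
      rw [map_smul, hw, if_neg (fun h => hne ((hx B hB).1 h)), smul_zero]
  have := hli.cardinal_le_rank
  rwa [Cardinal.mk_set] at this
end

section
/- Let Ω be an infinite set and let M be the monoid of all binary relations on Ω under relation composition. Then the endomorphism monoid of the free M-act on Ω has a dual embedding; that is, there exists an injective map ε from the M-act endomorphisms of M × Ω to themselves satisfying ε(f∘g) = ε(g)∘ε(f) for all such endomorphisms f, g. -/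
/-- Composition of binary relations on `Ω`:
`RelComp α β = {(x,y) : ∃ z, (x,z) ∈ β ∧ (z,y) ∈ α}`. -/
def RelComp {Ω : Type u} (α β : Set (Ω × Ω)) : Set (Ω × Ω) :=
  {p | ∃ z, (p.1, z) ∈ β ∧ (z, p.2) ∈ α}

/-- The endomorphisms of the free `Rel Ω`-act on `Ω`, i.e. maps
`h : Rel Ω × Ω → Rel Ω × Ω` commuting with the action `m · (t,p) = (m ∘ t, p)`. -/
def FreeRelActEnd (Ω : Type u) : Type u :=
  {h : Set (Ω × Ω) × Ω → Set (Ω × Ω) × Ω //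
    ∀ (m : Set (Ω × Ω)) (x : Set (Ω × Ω) × Ω),
      h (RelComp m x.1, x.2) = (RelComp m (h x).1, (h x).2)}

/-- The diagonal relation. -/
def diagRel (Ω : Type u) : Set (Ω × Ω) := {p | p.1 = p.2}

theorem relComp_diag {Ω : Type u} (m : Set (Ω × Ω)) : RelComp m (diagRel Ω) = m := by
  ext ⟨x, y⟩
  simp [RelComp, diagRel]

theorem relComp_assoc {Ω : Type u} (a b c : Set (Ω × Ω)) :
    RelComp (RelComp a b) c = RelComp a (RelComp b c) := by
  ext ⟨x, y⟩
  simp only [RelComp, Set.mem_setOf_eq]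
  constructor
  · rintro ⟨z, hz, w, hw, h⟩
    exact ⟨w, ⟨z, hz, hw⟩, h⟩
  · rintro ⟨w, ⟨z, hz, hw⟩, h⟩
    exact ⟨z, hz, w, hw, h⟩

theorem end_apply {Ω : Type u} (f : FreeRelActEnd Ω) (m : Set (Ω × Ω)) (p : Ω) :
    f.1 (m, p) = (RelComp m (f.1 (diagRel Ω, p)).1, (f.1 (diagRel Ω, p)).2) := by
  have h := f.2 m (diagRel Ω, p)
  simpa only [relComp_diag] using h

/-- Extension of the converse of a relation to one extra point, related to itself only. -/
def extRel {Ω : Type u} (a : Set (Ω × Ω)) : Option Ω → Option Ω → Prop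
  | none, none => True
  | some y, some x => (x, y) ∈ a
  | _, _ => False

theorem extRel_comp {Ω : Type u} (b a : Set (Ω × Ω)) (u v : Option Ω) :
    extRel (RelComp b a) u v ↔ ∃ w, extRel b u w ∧ extRel a w v := by
  cases u <;> cases v <;> simp [extRel, Option.exists, RelComp, and_comm]

/-- An endomorphism as a relation on `Option Ω × Ω`. -/
def relOf {Ω : Type u} (f : FreeRelActEnd Ω) (u v : Option Ω × Ω) : Prop :=
  v.2 = (f.1 (diagRel Ω, u.2)).2 ∧ extRel (f.1 (diagRel Ω, u.2)).1 u.1 v.1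

theorem relOf_comp {Ω : Type u} (f g h : FreeRelActEnd Ω) (e : h.1 = f.1 ∘ g.1)
    (u v : Option Ω × Ω) : relOf h u v ↔ ∃ w, relOf g u w ∧ relOf f w v := by
  have key : h.1 (diagRel Ω, u.2) = (RelComp (g.1 (diagRel Ω, u.2)).1
      (f.1 (diagRel Ω, (g.1 (diagRel Ω, u.2)).2)).1,
      (f.1 (diagRel Ω, (g.1 (diagRel Ω, u.2)).2)).2) := by
    rw [e, Function.comp_apply]
    exact end_apply f _ _
  unfold relOf
  rw [key]
  simp only [extRel_comp]
  constructor
  · rintro ⟨h1, w, h2, h3⟩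
    exact ⟨(w, _), ⟨rfl, h2⟩, h1, h3⟩
  · rintro ⟨⟨w, q⟩, ⟨h0, h2⟩, h1, h3⟩
    simp only at h0
    subst h0
    exact ⟨h1, w, h2, h3⟩

theorem relOf_inj {Ω : Type u} (f g : FreeRelActEnd Ω)
    (h : ∀ u v, relOf f u v ↔ relOf g u v) : f = g := by
  apply Subtype.ext
  funext ⟨m, p⟩
  have h2 : (f.1 (diagRel Ω, p)).2 = (g.1 (diagRel Ω, p)).2 :=
    ((h (none, p) (none, (f.1 (diagRel Ω, p)).2)).1 ⟨rfl, trivial⟩).1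
  have h1 : (f.1 (diagRel Ω, p)).1 = (g.1 (diagRel Ω, p)).1 := by
    ext ⟨x, y⟩
    have := h (some y, p) (some x, (f.1 (diagRel Ω, p)).2)
    simpa [relOf, extRel, h2] using this
  rw [end_apply f, end_apply g, h1, h2]

/-- The endomorphism given by right multiplication. -/
def rightMul {Ω : Type u} (a : Set (Ω × Ω)) : FreeRelActEnd Ω :=
  ⟨fun x => (RelComp x.1 a, x.2), fun m x => by simp only [relComp_assoc]⟩

theorem exists_equiv (Ω : Type u) [Infinite Ω] : Nonempty (Option Ω × Ω ≃ Ω) := by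
  have hc : Cardinal.aleph0 ≤ Cardinal.mk Ω := Cardinal.aleph0_le_mk Ω
  rw [← Cardinal.eq]
  rw [Cardinal.mk_prod, Cardinal.lift_id, Cardinal.lift_id, Cardinal.mk_option,
    Cardinal.add_one_eq hc, Cardinal.mul_eq_self hc]

/-- For an infinite set `Ω` and `M = Rel Ω` the monoid of binary
relations on `Ω`, the endomorphism monoid of the free `M`-act on `Ω` has a dual
embedding. -/
theorem stmt_14 {Ω : Type u} [Infinite Ω] :
    ∃ ε : FreeRelActEnd Ω → FreeRelActEnd Ω, Function.Injective ε ∧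
      ∀ f g h : FreeRelActEnd Ω, h.1 = f.1 ∘ g.1 → (ε h).1 = (ε g).1 ∘ (ε f).1 := by
  obtain ⟨e⟩ := exists_equiv Ω
  refine ⟨fun f => rightMul {p | relOf f (e.symm p.1) (e.symm p.2)}, ?_, ?_⟩
  · intro f g hfg
    apply relOf_inj
    intro u v
    have h1 : (rightMul {p | relOf f (e.symm p.1) (e.symm p.2)}).1 (diagRel Ω, e u) =
      (rightMul {p | relOf g (e.symm p.1) (e.symm p.2)}).1 (diagRel Ω, e u) :=
      congrFun (congrArg Subtype.val hfg) _
    have h2 := congrArg (fun x : Set (Ω × Ω) × Ω => (e u, e v) ∈ x.1) h1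
    simpa [rightMul, RelComp, diagRel] using h2
  · intro f g h hh
    funext ⟨m, p⟩
    simp only [rightMul, Function.comp_apply, relComp_assoc]
    congr 2
    ext ⟨x, y⟩
    simp only [RelComp, Set.mem_setOf_eq, relOf_comp f g h hh]
    exact e.exists_congr (by simp)
end

section
/- Let M be a monoid and Ω an infinite set. Define the left divisibility preorder on M by u ⊴ v iff there exists t ∈ M with v = t·u, and call a subset A ⊆ M an antichain if no two distinct elements of A are comparable under ⊴. If every antichain of M under left divisibility has cardinality at most |Ω|, then the endomorphism monoid of the free M-act on Ω has no dual embedding; that is, there is no injective map ε from the M-act endomorphisms of M × Ω to themselves satisfying ε(f∘g) = ε(g)∘ε(f). -/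
/-- Let `M` be a monoid and `Ω` an infinite set. If every antichain of
`M` under the left divisibility preorder (`u ⊴ v` iff `v = t·u` for some `t`) has
cardinality at most `|Ω|`, then the endomorphism monoid of the free `M`-act on `Ω`
has no dual embedding. -/
theorem stmt_15 {M : Type u} [Monoid M] {Ω : Type u} [Infinite Ω]
    (hchain : ∀ A : Set M, (∀ u ∈ A, ∀ v ∈ A, u ≠ v → ¬∃ t, v = t * u) →
      Cardinal.mk A ≤ Cardinal.mk Ω) :
    ¬∃ ε : {h : M × Ω → M × Ω //
          ∀ (m : M) (x : M × Ω), h (m * x.1, x.2) = (m * (h x).1, (h x).2)} →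
        {h : M × Ω → M × Ω //
          ∀ (m : M) (x : M × Ω), h (m * x.1, x.2) = (m * (h x).1, (h x).2)},
      Function.Injective ε ∧
      ∀ f g h, h.1 = f.1 ∘ g.1 → (ε h).1 = (ε g).1 ∘ (ε f).1 := by
  classical
  rintro ⟨ε, hinj, hε⟩
  -- the endomorphism induced by a self-map of `Ω`
  let T : (Ω → Ω) → {h : M × Ω → M × Ω //
      ∀ (m : M) (x : M × Ω), h (m * x.1, x.2) = (m * (h x).1, (h x).2)} :=
    fun f => ⟨fun x => (x.1, f x.2), fun m x => rfl⟩
  obtain ⟨p0, q0, hpq⟩ := exists_pair_ne Ω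
  have hne : ε (T fun _ => p0) ≠ ε (T fun _ => q0) := by
    intro h
    have h2 := congrArg (fun k => (k.1 (1, p0)).2) (hinj h)
    exact hpq h2
  obtain ⟨x, hx⟩ : ∃ x, (ε (T fun _ => p0)).1 x ≠ (ε (T fun _ => q0)).1 x := by
    by_contra! hcon
    exact hne (Subtype.ext (funext hcon))
  have hφ : ∀ (f : Ω → Ω) (r : Ω),
      (ε (T fun _ => r)).1 ((ε (T f)).1 x) = (ε (T fun _ => f r)).1 x := by
    intro f r
    have h := hε (T f) (T fun _ => r) (T fun _ => f r) rfl
    exact (congrFun h x).symm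
  obtain ⟨e⟩ : Nonempty (Ω ≃ Option (Option Ω)) := by
    apply Cardinal.eq.1
    simp [Cardinal.mk_option, Cardinal.add_one_eq (Cardinal.aleph0_le_mk Ω)]
  let F : Set Ω → Ω → Ω := fun A r =>
    match e r with
    | none => p0
    | some none => q0
    | some (some w) => if w ∈ A then q0 else p0
  have F0 : ∀ A, F A (e.symm none) = p0 := by intro A; simp [F]
  have F1 : ∀ A, F A (e.symm (some none)) = q0 := by intro A; simp [F]
  have F2 : ∀ A w, F A (e.symm (some (some w))) = if w ∈ A then q0 else p0 := by
    intro A w; simp [F]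
  let y : Set Ω → M × Ω := fun A => (ε (T (F A))).1 x
  have key : ∀ (A B : Set Ω) (t : M), (y A).2 = (y B).2 → (y B).1 = t * (y A).1 → A = B := by
    intro A B t h2 h1
    have hy : y B = (t * (y A).1, (y A).2) := Prod.ext h1 h2.symm
    have hr : ∀ r, (ε (T fun _ => F B r)).1 x =
        (t * ((ε (T fun _ => F A r)).1 x).1, ((ε (T fun _ => F A r)).1 x).2) := by
      intro r
      rw [← hφ (F B) r, ← hφ (F A) r]
      change (ε (T fun _ => r)).1 (y B) = _
      rw [hy]
      exact (ε (T fun _ => r)).2 t (y A)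
    have ha := hr (e.symm none)
    have hb := hr (e.symm (some none))
    rw [F0, F0] at ha
    rw [F1, F1] at hb
    ext w
    have hw := hr (e.symm (some (some w)))
    rw [F2, F2] at hw
    by_cases hA : w ∈ A <;> by_cases hB : w ∈ B
    · simp [hA, hB]
    · rw [if_pos hA, if_neg hB, ← hb] at hw
      exact absurd hw hx
    · rw [if_neg hA, if_pos hB, ← ha] at hw
      exact absurd hw.symm hx
    · simp [hA, hB]
  have hemb : ∀ w : Ω, Nonempty ({m : M | ∃ A, y A = (m, w)} ↪ Ω) := by
    intro w
    apply hchain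
    rintro u ⟨A, hA⟩ v ⟨B, hB⟩ huv ⟨t, ht⟩
    have hAB : A = B := key A B t (by rw [hA, hB]) (by rw [hA, hB]; exact ht)
    subst hAB
    exact huv (congrArg Prod.fst (hA.symm.trans hB))
  let i := fun w => Classical.choice (hemb w)
  obtain ⟨pr⟩ : Nonempty (Ω × Ω ≃ Ω) := by
    apply Cardinal.eq.1
    simp [Cardinal.mk_prod]
  let G : Set Ω → Ω := fun A => pr ((y A).2, i (y A).2 ⟨(y A).1, A, rfl⟩)
  refine Function.cantor_injective G ?_
  intro A B hG
  have h := pr.injective hG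
  have hgen : ∀ (w w' : Ω) (a : {m : M | ∃ A, y A = (m, w)})
      (b : {m : M | ∃ A, y A = (m, w')}), w = w' → i w a = i w' b → a.1 = b.1 := by
    intro w w' a b hw hab
    subst hw
    rw [(i w).injective hab]
  have h2 := congrArg Prod.fst h
  have h1 := hgen _ _ _ _ h2 (congrArg Prod.snd h)
  exact key A B 1 h2 (by rw [one_mul]; exact h1.symm)
end

section
/- Let M be a monoid and Ω a nonempty set. For a subset X of the free M-act M × Ω, let ⟨X⟩ = {m·x : m ∈ M, x ∈ X} be the subact generated by X. Then the following matroid exchange condition holds for M × Ω if and only if every element of M is invertible (i.e. M is a group): for every subset X of M × Ω and all elements u, v of M × Ω, if u ∈ ⟨X ∪ {v}⟩ and u ∉ ⟨X⟩, then v ∈ ⟨X ∪ {u}⟩. -/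
/-- For a monoid `M` and a nonempty set `Ω`, the free `M`-act `M × Ω`
(with subact generated by `X` being `⟨X⟩ = {m·x : m ∈ M, x ∈ X}`) satisfies the
matroid exchange condition iff every element of `M` is invertible, i.e. `M` is a
group. -/
theorem stmt_16 {M : Type u} [Monoid M] {Ω : Type v} [Nonempty Ω] :
    (∀ (X : Set (M × Ω)) (u v : M × Ω),
        u ∈ {y | ∃ m : M, ∃ x ∈ X ∪ {v}, y = (m * x.1, x.2)} →
        u ∉ {y | ∃ m : M, ∃ x ∈ X, y = (m * x.1, x.2)} →
        v ∈ {y | ∃ m : M, ∃ x ∈ X ∪ {u}, y = (m * x.1, x.2)}) ↔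
      ∀ m : M, IsUnit m := by
  constructor
  · intro h
    obtain ⟨p⟩ := ‹Nonempty Ω›
    have key : ∀ m : M, ∃ n : M, n * m = 1 := by
      intro m
      obtain ⟨n, x, hx, hn⟩ := h ∅ (m, p) (1, p)
        ⟨m, (1, p), Or.inr rfl, by simp⟩
        (by rintro ⟨_, _, hx, _⟩; exact hx)
      rcases hx with hx | hx
      · exact hx.elim
      · rw [Set.mem_singleton_iff] at hx
        subst hx
        exact ⟨n, (congrArg Prod.fst hn).symm⟩
    intro m
    obtain ⟨n, hn⟩ := key m
    obtain ⟨k, hk⟩ := key n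
    have hkm : k = m := left_inv_eq_right_inv hk hn
    subst hkm
    exact ⟨⟨k, n, hk, hn⟩, rfl⟩
  · rintro h X u v ⟨m, x, hx, hu⟩ hnot
    rcases hx with hx | hx
    · exact (hnot ⟨m, x, hx, hu⟩).elim
    · rw [Set.mem_singleton_iff] at hx
      subst hx
      obtain ⟨w, rfl⟩ := h m
      refine ⟨(↑w⁻¹ : M), u, Or.inr rfl, ?_⟩
      subst hu
      simp
end

section
/- Let G be a group and Ω an infinite set. Then the endomorphism monoid of the free G-act G × Ω has no dual embedding; that is, there is no injective map ε from the G-act endomorphisms of G × Ω to themselves satisfying ε(f∘g) = ε(g)∘ε(f) for all such endomorphisms f, g. -/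
/-- For a group `G` and an infinite set `Ω`, the endomorphism monoid
of the free `G`-act `G × Ω` has no dual embedding. -/
theorem stmt_17 {G : Type u} [Group G] {Ω : Type v} [Infinite Ω] :
    ¬∃ ε : {h : G × Ω → G × Ω //
          ∀ (g : G) (x : G × Ω), h (g * x.1, x.2) = (g * (h x).1, (h x).2)} →
        {h : G × Ω → G × Ω //
          ∀ (g : G) (x : G × Ω), h (g * x.1, x.2) = (g * (h x).1, (h x).2)},
      Function.Injective ε ∧
      ∀ f g h, h.1 = f.1 ∘ g.1 → (ε h).1 = (ε g).1 ∘ (ε f).1 := by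
  classical
  rintro ⟨ε, hinj, hε⟩
  let L : (Ω → Ω) → {h : G × Ω → G × Ω //
      ∀ (g : G) (x : G × Ω), h (g * x.1, x.2) = (g * (h x).1, (h x).2)} :=
    fun f => ⟨fun x => (x.1, f x.2), fun _ _ => rfl⟩
  have key : ∀ (f : Ω → Ω) (x : Ω) (p : G × Ω),
      (ε (L (fun _ => x))).1 ((ε (L f)).1 p) = (ε (L (fun _ => f x))).1 p := by
    intro f x p
    have h := hε (L f) (L (fun _ => x)) (L (fun _ => f x)) rfl
    exact (congrFun h p).symm
  obtain ⟨a, b, hab⟩ := exists_pair_ne Ω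
  have hp : ∃ p, (ε (L (fun _ => a))).1 p ≠ (ε (L (fun _ => b))).1 p := by
    by_contra hcon
    push Not at hcon
    have h1 := hinj (Subtype.ext (funext hcon))
    have h2 := congrFun (congrArg Subtype.val h1) ((1 : G), a)
    exact hab (congrArg Prod.snd h2)
  obtain ⟨p, hp⟩ := hp
  have hs : Nonempty (Option Ω ≃ Ω) := by
    rw [← Cardinal.lift_mk_eq']
    simp [Cardinal.mk_option, Cardinal.add_one_eq (Cardinal.aleph0_le_mk Ω)]
  obtain ⟨s⟩ := hs
  let F : Set Ω → Ω → Ω := fun A x =>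
    match s.symm x with
    | none => a
    | some y => if y ∈ A then a else b
  have F0 : ∀ A, F A (s none) = a := by intro A; simp [F]
  have F1 : ∀ A y, F A (s (some y)) = if y ∈ A then a else b := by intro A y; simp [F]
  refine Function.cantor_injective (fun A : Set Ω => ((ε (L (F A))).1 p).2) ?_
  intro A B hAB
  have hAB : ((ε (L (F A))).1 p).2 = ((ε (L (F B))).1 p).2 := hAB
  have e1 : ((ε (L (F B))).1 p) = ((((ε (L (F B))).1 p).1 * (((ε (L (F A))).1 p).1)⁻¹) *
      ((ε (L (F A))).1 p).1, ((ε (L (F A))).1 p).2) := by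
    ext
    · simp
    · exact hAB.symm
  have e2 := (ε (L (fun _ => s none))).2
    (((ε (L (F B))).1 p).1 * (((ε (L (F A))).1 p).1)⁻¹) ((ε (L (F A))).1 p)
  rw [← e1, key, key, F0, F0] at e2
  have e3 := congrArg Prod.fst e2
  have e4 : ((ε (L (F B))).1 p).1 * (((ε (L (F A))).1 p).1)⁻¹ = 1 := by
    simpa using e3
  have e5 : (ε (L (F A))).1 p = (ε (L (F B))).1 p := by
    ext
    · exact (mul_inv_eq_one.mp e4).symm
    · exact hAB
  ext y
  have e6 := key (F A) (s (some y)) p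
  rw [e5, key, F1, F1] at e6
  by_cases hA : y ∈ A <;> by_cases hB : y ∈ B <;> simp only [hA, hB, if_true, if_false] at e6 ⊢
  · exact absurd e6.symm hp
  · exact absurd e6 hp
end

section
/- Let κ be an infinite cardinal and let R be a ring that is left κ⁺-noetherian, i.e. there is no strictly increasing family of left ideals of R indexed by the ordinals below the successor cardinal κ⁺. Let Ω be a set with |Ω| ≥ κ. Then every C-independent subset of the free left R-module R^{(Ω)} (finitely supported functions Ω → R) has cardinality at most |Ω|; here a subset s of a module is C-independent if for every x ∈ s, x does not belong to the submodule spanned by s \ {x}. -/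
open Cardinal in
theorem ideal_gen {R : Type u} [Ring R] (κ : Cardinal.{u})
    (hR : ¬∃ f : {o : Ordinal.{u} // o < (Order.succ κ).ord} → Ideal R, StrictMono f)
    (I : Ideal R) : ∃ G : Set R, #G ≤ κ ∧ Submodule.span R G = I := by
  classical
  by_contra hcon
  push Not at hcon
  apply hR
  have key : ∀ G : Set R, G ⊆ I → #G ≤ κ → ∃ x ∈ I, x ∉ Submodule.span R G := by
    intro G hG hc
    by_contra h
    push Not at h
    exact hcon G hc (le_antisymm (Submodule.span_le.2 hG) h)
  let P : Set R → R := fun G =>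
    if h : ∃ x ∈ I, x ∉ Submodule.span R G then h.choose else 0
  have hP0 : ∀ G, P G ∈ I := by
    intro G
    by_cases h : ∃ x ∈ I, x ∉ Submodule.span R G
    · simp only [P, dif_pos h]; exact h.choose_spec.1
    · simp only [P, dif_neg h]; exact I.zero_mem
  have hP1 : ∀ G : Set R, G ⊆ I → #G ≤ κ → P G ∉ Submodule.span R G := by
    intro G hG hc
    have h := key G hG hc
    simp only [P, dif_pos h]; exact h.choose_spec.2
  let g : Ordinal.{u} → R := (Ordinal.lt_wf).fix
    (fun o ih => P {y | ∃ o', ∃ h : o' < o, ih o' h = y})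
  have hg : ∀ o, g o = P (g '' Set.Iio o) := by
    intro o
    have := (Ordinal.lt_wf).fix_eq
      (fun o (ih : ∀ o', o' < o → R) => P {y | ∃ o', ∃ h : o' < o, ih o' h = y}) o
    refine this.trans ?_
    congr 1
    ext y
    simp [g]
  have hgI : ∀ o, g o ∈ I := fun o => by rw [hg]; exact hP0 _
  refine ⟨fun o => Submodule.span R (g '' Set.Iio o.1), ?_⟩
  rintro ⟨a, ha⟩ ⟨b, hb⟩ hab
  have hab' : a < b := hab
  refine lt_of_le_of_ne (Submodule.span_mono (Set.image_mono (Set.Iio_subset_Iio hab'.le))) ?_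
  intro heq
  have h1 : g a ∉ Submodule.span R (g '' Set.Iio a) := by
    rw [hg a]
    apply hP1
    · rintro _ ⟨o, -, rfl⟩; exact hgI o
    · have h2 := Cardinal.mk_image_le_lift (f := g) (s := Set.Iio a)
      rw [Cardinal.mk_Iio_ordinal] at h2
      have h3 : a.card ≤ κ := Order.lt_succ_iff.1 (Cardinal.lt_ord.1 ha)
      rw [Cardinal.lift_lift] at h2
      exact (Cardinal.lift_le.1 h2).trans h3
  apply h1
  have : g a ∈ Submodule.span R (g '' Set.Iio b) :=
    Submodule.subset_span ⟨a, hab', rfl⟩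
  exact heq.symm.le this

open Cardinal in
theorem submodule_gen {R : Type u} [Ring R] (κ : Cardinal.{u}) (hκ : ℵ₀ ≤ κ)
    (hR : ∀ I : Ideal R, ∃ G : Set R, #G ≤ κ ∧ Submodule.span R G = I)
    {Ω : Type u} (hΩ : κ ≤ #Ω) (N : Submodule R (Ω →₀ R)) :
    ∃ G : Set (Ω →₀ R), #G ≤ #Ω ∧ Submodule.span R G = N := by
  classical
  obtain ⟨_, _⟩ := exists_wellFoundedLT Ω
  let M : Ω → Submodule R (Ω →₀ R) := fun i => N ⊓ Finsupp.supported R R (Set.Iic i)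
  choose G hGc hG using fun i => hR ((M i).map (Finsupp.lapply i))
  have hl : ∀ i (r : G i), ∃ x ∈ M i, x i = r := by
    intro i r
    have : (r : R) ∈ (M i).map (Finsupp.lapply i) := by
      rw [← hG i]; exact Submodule.subset_span r.2
    obtain ⟨x, hx, hxr⟩ := this
    exact ⟨x, hx, hxr⟩
  choose l hlM hlr using hl
  have hsub : (⋃ i, Set.range (l i)) ⊆ (N : Set (Ω →₀ R)) := by
    rintro x hx
    obtain ⟨i, r, rfl⟩ := Set.mem_iUnion.1 hx
    exact (hlM i r).1
  refine ⟨⋃ i, Set.range (l i), ?_, le_antisymm (Submodule.span_le.2 hsub) ?_⟩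
  · refine (Cardinal.mk_iUnion_le_sum_mk).trans ?_
    refine (Cardinal.sum_le_sum _ (fun _ => κ) (fun i => mk_range_le.trans (hGc i))).trans ?_
    rw [Cardinal.sum_const', Cardinal.mul_eq_left (hκ.trans hΩ) hΩ]
    exact (aleph0_pos.trans_le hκ).ne'
  · have claim : ∀ i, ∀ x ∈ M i, x ∈ Submodule.span R (⋃ i, Set.range (l i)) := by
      intro i
      induction i using WellFoundedLT.induction with
      | ind i ih =>
      intro x hx
      have h1 : ∃ y ∈ Submodule.span R (Set.range (l i)), y i = x i := by
        have h2 : x i ∈ (M i).map (Finsupp.lapply i) := ⟨x, hx, rfl⟩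
        have h3 : (Submodule.span R (Set.range (l i))).map (Finsupp.lapply i)
            = (M i).map (Finsupp.lapply (R := R) i) := by
          rw [← hG i, Submodule.map_span]
          congr 1
          ext r
          constructor
          · rintro ⟨_, ⟨r, rfl⟩, rfl⟩
            simp [hlr]
          · intro hr
            exact ⟨_, ⟨⟨r, hr⟩, rfl⟩, hlr i ⟨r, hr⟩⟩
        rw [← h3] at h2
        exact h2
      obtain ⟨y, hy, hyx⟩ := h1
      have hyM : y ∈ M i := by
        refine (Submodule.span_le.2 ?_ : Submodule.span R (Set.range (l i)) ≤ M i) hy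
        rintro _ ⟨r, rfl⟩
        exact hlM i r
      have hyS := Submodule.span_mono (Set.subset_iUnion (fun i => Set.range (l i)) i) hy
      have hd : x - y ∈ M i := (M i).sub_mem hx hyM
      suffices h : x - y ∈ Submodule.span R (⋃ i, Set.range (l i)) by
        have := Submodule.add_mem _ h hyS
        rwa [sub_add_cancel] at this
      by_cases h0 : x - y = 0
      · rw [h0]; exact Submodule.zero_mem _
      have hne : (x - y).support.Nonempty := Finsupp.support_nonempty_iff.2 h0
      have hmem := Finset.max'_mem _ hne
      refine ih ((x - y).support.max' hne) (lt_of_le_of_ne ?_ ?_) _ ⟨hd.1, ?_⟩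
      · exact (Finsupp.mem_supported R _).1 hd.2 hmem
      · intro he
        rw [he, Finsupp.mem_support_iff] at hmem
        apply hmem
        simp [hyx]
      · refine (Finsupp.mem_supported R _).2 fun j hj => ?_
        exact Finset.le_max' _ _ hj
    intro x hx
    by_cases h0 : x = 0
    · rw [h0]; exact Submodule.zero_mem _
    have hne : x.support.Nonempty := Finsupp.support_nonempty_iff.2 h0
    refine claim (x.support.max' hne) x ⟨hx, ?_⟩
    exact (Finsupp.mem_supported R _).2 fun j hj => Finset.le_max' _ _ hj

/-- Let `κ` be an infinite cardinal, `R` a left `κ⁺`-noetherian ring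
(no strictly increasing family of left ideals indexed by the ordinals below `κ⁺`),
and `Ω` a set with `|Ω| ≥ κ`. Then every C-independent subset of the free left
module `R^{(Ω)}` has cardinality at most `|Ω|`. -/
theorem stmt_18 {R : Type u} [Ring R] (κ : Cardinal.{u}) (hκ : Cardinal.aleph0 ≤ κ)
    (hR : ¬∃ f : {o : Ordinal.{u} // o < (Order.succ κ).ord} → Ideal R, StrictMono f)
    {Ω : Type u} (hΩ : κ ≤ Cardinal.mk Ω)
    (s : Set (Ω →₀ R)) (hs : ∀ x ∈ s, x ∉ Submodule.span R (s \ {x})) :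
    Cardinal.mk s ≤ Cardinal.mk Ω := by
  classical
  obtain ⟨G, hGc, hG⟩ := submodule_gen κ hκ (ideal_gen κ hR) hΩ (Submodule.span R s)
  have h1 : ∀ y : G, ∃ T : Finset (Ω →₀ R), (T : Set (Ω →₀ R)) ⊆ s ∧
      (y : Ω →₀ R) ∈ Submodule.span R (T : Set (Ω →₀ R)) := fun y =>
    Submodule.mem_span_finite_of_mem_span (hG ▸ Submodule.subset_span y.2)
  choose T hTs hT using h1
  have hsT : s ⊆ ⋃ y, (T y : Set (Ω →₀ R)) := by
    intro x hx
    by_contra hxT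
    apply hs x hx
    have h2 : x ∈ Submodule.span R G := hG ▸ Submodule.subset_span hx
    refine (Submodule.span_le.2 ?_ : Submodule.span R G ≤ _) h2
    intro y hy
    refine Submodule.span_mono ?_ (hT ⟨y, hy⟩)
    intro z hz
    refine ⟨hTs _ hz, ?_⟩
    rintro rfl
    exact hxT (Set.mem_iUnion.2 ⟨_, hz⟩)
  refine (Cardinal.mk_le_mk_of_subset hsT).trans (Cardinal.mk_iUnion_le_sum_mk.trans ?_)
  refine (Cardinal.sum_le_sum _ (fun _ => Cardinal.aleph0)
    (fun y => (Cardinal.lt_aleph0_of_finite _).le)).trans ?_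
  rw [Cardinal.sum_const']
  exact (mul_le_mul' hGc (hκ.trans hΩ)).trans (Cardinal.mul_eq_self (hκ.trans hΩ)).le
end
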